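/- Let P = (x₁,…,xₙ : r₁,…,r_m) be a finite presentation of a group G satisfying condition (2.1) with distinct orders q₁,…,q_p, and let w be a word in x₁,…,xₙ. Then the group G_w presented by Q_w is trivial if and only if [w] = 1 in G. -/

import Mathlib

/-- Generators of the presentation `Q_w`: `Sum.inl i` is the generator `xᵢ`
(for `i : Fin n`), while `Sum.inr 0 = a`, `Sum.inr 1 = α`, `Sum.inr 2 = b`,
`Sum.inr 3 = β`. -/
abbrev QwGen (n : ℕ) := Fin n ⊕ Fin 4

/-- The relators of the presentation `Q_w`: the relators `r₁, …, r_m` (indexed by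
`Sum.inl j`), the relators (iii)/(iv) (indexed by `Sum.inr (Sum.inl i)`, zero-based:
for `i < p` the relator `a^{-qᵢ} xᵢ α^{qᵢ} (β^{-(i+1)} b β^{i+1})⁻¹` and for
`p ≤ i < n` the relator `a^{-(q+i+1)} xᵢ α^{q+i+1} (β^{-(i+1)} b β^{i+1})⁻¹`, where
`q = max {q₁, …, q_p}`), and the relators (i), (ii), (v)
(indexed by `Sum.inr (Sum.inr t)` for `t = 0, 1, 2`). -/
def qwRel (n m p : ℕ) (r : Fin m → FreeGroup (Fin n)) (q : Fin p → ℕ)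
    (w : FreeGroup (Fin n)) : Fin m ⊕ (Fin n ⊕ Fin 3) → FreeGroup (QwGen n) :=
  let a : FreeGroup (QwGen n) := FreeGroup.of (Sum.inr 0)
  let al : FreeGroup (QwGen n) := FreeGroup.of (Sum.inr 1)
  let b : FreeGroup (QwGen n) := FreeGroup.of (Sum.inr 2)
  let be : FreeGroup (QwGen n) := FreeGroup.of (Sum.inr 3)
  let x : Fin n → FreeGroup (QwGen n) := fun i => FreeGroup.of (Sum.inl i)
  let W : FreeGroup (QwGen n) := FreeGroup.map Sum.inl w
  let Q : ℕ := Finset.univ.sup q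
  fun j => match j with
  | Sum.inl j => FreeGroup.map Sum.inl (r j)
  | Sum.inr (Sum.inl i) =>
      if h : (i : ℕ) < p then
        a ^ (-(q ⟨i, h⟩ : ℤ)) * x i * al ^ (q ⟨i, h⟩) *
          (be ^ (-((i : ℕ) + 1 : ℤ)) * b * be ^ ((i : ℕ) + 1))⁻¹
      else
        a ^ (-((Q + (i : ℕ) + 1 : ℕ) : ℤ)) * x i * al ^ (Q + (i : ℕ) + 1) *
          (be ^ (-((i : ℕ) + 1 : ℤ)) * b * be ^ ((i : ℕ) + 1))⁻¹
  | Sum.inr (Sum.inr t) =>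
      if t = 0 then a * al * a⁻¹ * (b ^ 2)⁻¹
      else if t = 1 then al * a * al⁻¹ * (b * be * b⁻¹)⁻¹
      else (W * al ^ 2 * W⁻¹ * (al ^ 2)⁻¹) *
        (be ^ (-((n : ℤ) + 1)) * b * be ^ (n + 1))⁻¹

/-- Ping-pong in predicate form. -/
lemma qw_ping_pong {J K Ω : Type} [Nontrivial J] [Group K] [MulAction K Ω] (u : J → K)
    (X Y : J → Ω → Prop) (ω₀ : Ω) (h0 : ∀ j, ¬ Y j ω₀)
    (hXX : ∀ i j ω, X i ω → X j ω → i = j)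
    (hYY : ∀ i j ω, Y i ω → Y j ω → i = j)
    (hXY : ∀ i j ω, X i ω → Y j ω → False)
    (hX : ∀ i ω, ¬ Y i ω → X i (u i • ω))
    (hY : ∀ i ω, ¬ X i ω → Y i ((u i)⁻¹ • ω)) :
    Function.Injective (FreeGroup.lift u) := by
  refine FreeGroup.injective_lift_of_ping_pong u (fun j => {ω | X j ω}) (fun j => {ω | Y j ω})
    (fun j => ⟨u j • ω₀, hX j _ (h0 j)⟩) ?_ ?_ ?_ ?_ ?_
  · intro i j hij
    exact Set.disjoint_left.2 fun ω h1 h2 => hij (hXX i j ω h1 h2)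
  · intro i j hij
    exact Set.disjoint_left.2 fun ω h1 h2 => hij (hYY i j ω h1 h2)
  · intro i j
    exact Set.disjoint_left.2 fun ω h1 h2 => hXY i j ω h1 h2
  · rintro i _ ⟨ω, h, rfl⟩
    exact hX i ω h
  · rintro i _ ⟨ω, h, rfl⟩
    exact hY i ω h

/-- The elements on the `G * F(a, α)` side. -/
def qwU {n : ℕ} {K : Type} [Group K] (x : Fin n → K) (W a al : K) (e : Fin n → ℕ) :
    Fin n ⊕ Fin 3 → K
  | Sum.inl i => a ^ (-(e i : ℤ)) * x i * al ^ (e i : ℤ)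
  | Sum.inr t => if t = 0 then a ^ (1 : ℤ) * al ^ (1 : ℤ) * a ^ (-1 : ℤ)
      else if t = 1 then al ^ (1 : ℤ) * a ^ (1 : ℤ) * al ^ (-1 : ℤ)
      else W * al ^ (2 : ℤ) * W⁻¹ * al ^ (-2 : ℤ)

/-- The elements on the `F(b, β)` side. -/
def qwV (n : ℕ) {K : Type} [Group K] (b be : K) : Fin n ⊕ Fin 3 → K
  | Sum.inl i => be ^ (-((i : ℕ) + 1 : ℤ)) * b ^ (1 : ℤ) * be ^ ((i : ℕ) + 1 : ℤ)
  | Sum.inr t => if t = 0 then b ^ (2 : ℤ)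
      else if t = 1 then b ^ (1 : ℤ) * be ^ (1 : ℤ) * b ^ (-1 : ℤ)
      else be ^ (-(n + 1 : ℤ)) * b ^ (1 : ℤ) * be ^ (n + 1 : ℤ)

lemma fin3_cases (P : Fin 3 → Prop) (h0 : P 0) (h1 : P 1) (h2 : P 2) : ∀ t, P t := by
  intro t
  fin_cases t
  · exact h0
  · exact h1
  · exact h2

instance qwJ_nontrivial (n : ℕ) : Nontrivial (Fin n ⊕ Fin 3) :=
  ⟨Sum.inr 0, Sum.inr 1, by simp⟩

lemma qwV_injective (n : ℕ) {K Ω : Type} [Group K] [MulAction K Ω] (b be : K)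
    (A B : Ω → ℤ) (hA : ∀ (k : ℤ) ω, A (b ^ k • ω) = A ω + k)
    (hB : ∀ (k : ℤ) ω, B (be ^ k • ω) = B ω + k)
    (hAB : ∀ ω, A ω ≠ 0 → B ω = 0) (ω₀ : Ω) (hA0 : A ω₀ = 0) (hB0 : B ω₀ = 0) :
    Function.Injective (FreeGroup.lift (qwV n b be)) := by
  have hBA : ∀ ω, B ω ≠ 0 → A ω = 0 := fun ω h => by
    by_contra h'; exact h (hAB ω h')
  have key1 : ∀ (k : ℤ) ω, A (be ^ k • ω) ≠ 0 → B ω = -k := fun k ω h => by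
    have := hAB _ h; rw [hB] at this; omega
  have key2 : ∀ (k : ℤ) ω, B (b ^ k • ω) ≠ 0 → A ω = -k := fun k ω h => by
    have := hBA _ h; rw [hA] at this; omega
  have key3 : ∀ (k : ℤ), k ≠ 0 → A (be ^ k • ω₀) = 0 := fun k hk => by
    by_contra h; have := key1 _ _ h; omega
  have key4 : ∀ (k : ℤ), k ≠ 0 → B (b ^ k • ω₀) = 0 := fun k hk => by
    by_contra h; have := key2 _ _ h; omega
  let X : Fin n ⊕ Fin 3 → Ω → Prop := fun j ω => match j with
    | Sum.inl i => 0 < A (be ^ ((i : ℕ) + 1 : ℤ) • ω)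
    | Sum.inr t => if t = 0 then 2 ≤ A ω
        else if t = 1 then 0 < B (b ^ (-1 : ℤ) • ω)
        else 0 < A (be ^ (n + 1 : ℤ) • ω)
  let Y : Fin n ⊕ Fin 3 → Ω → Prop := fun j ω => match j with
    | Sum.inl i => A (be ^ ((i : ℕ) + 1 : ℤ) • ω) < 0
    | Sum.inr t => if t = 0 then A ω ≤ -1
        else if t = 1 then B (b ^ (-1 : ℤ) • ω) < 0
        else A (be ^ (n + 1 : ℤ) • ω) < 0
  have sepi : ∀ (i : Fin n) ω, X (Sum.inl i) ω ∨ Y (Sum.inl i) ω →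
      B ω = -((i : ℕ) + 1 : ℤ) := fun i ω h => by
    apply key1; rcases h with h | h <;> simp only [X, Y] at h <;> omega
  have sep0 : ∀ ω, X (Sum.inr 0) ω ∨ Y (Sum.inr 0) ω → A ω ≠ 0 ∧ A ω ≠ 1 := fun ω h => by
    rcases h with h | h <;> simp [X, Y] at h <;> omega
  have sep1 : ∀ ω, X (Sum.inr 1) ω ∨ Y (Sum.inr 1) ω → A ω = 1 := fun ω h => by
    apply key2 (-1); rcases h with h | h <;> simp [X, Y] at h ⊢ <;> omega
  have sep2 : ∀ ω, X (Sum.inr 2) ω ∨ Y (Sum.inr 2) ω → B ω = -(n + 1 : ℤ) := fun ω h => by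
    apply key1; rcases h with h | h <;> simp [X, Y] at h <;> omega
  have sep : ∀ i j ω, X i ω ∨ Y i ω → X j ω ∨ Y j ω → i = j := by
    intro i j ω
    have hAB' := hAB ω
    rcases i with i | i <;> rcases j with j | j
    · intro h1 h2
      have h1 := sepi _ _ h1
      have h2 := sepi _ _ h2
      congr 1; ext; omega
    · intro h1
      have h1 := sepi _ _ h1
      have := i.2
      revert j; apply fin3_cases <;> intro h2
      · have := sep0 _ h2; omega
      · have := sep1 _ h2; omega
      · have := sep2 _ h2; omega
    · intro h2 h1
      have h1 := sepi _ _ h1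
      have := j.2
      revert i; apply fin3_cases <;> intro h2
      · have := sep0 _ h2; omega
      · have := sep1 _ h2; omega
      · have := sep2 _ h2; omega
    · revert i j; apply fin3_cases <;> apply fin3_cases <;> intro h1 h2
      · rfl
      · have := sep0 _ h1; have := sep1 _ h2; omega
      · have := sep0 _ h1; have := sep2 _ h2; omega
      · have := sep1 _ h1; have := sep0 _ h2; omega
      · rfl
      · have := sep1 _ h1; have := sep2 _ h2; omega
      · have := sep2 _ h1; have := sep0 _ h2; omega
      · have := sep2 _ h1; have := sep1 _ h2; omega
      · rfl
  have anti : ∀ i ω, X i ω → Y i ω → False := by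
    intro i ω
    rcases i with i | i
    · simp only [X, Y]; intros; omega
    · revert i; apply fin3_cases <;> simp [X, Y] <;> intros <;> omega
  refine qw_ping_pong _ X Y ω₀ ?_ (fun i j ω h1 h2 => sep i j ω (.inl h1) (.inl h2))
    (fun i j ω h1 h2 => sep i j ω (.inr h1) (.inr h2))
    (fun i j ω h1 h2 => by
      have := sep i j ω (.inl h1) (.inr h2); subst this; exact anti i ω h1 h2) ?_ ?_
  · rintro (i | i)
    · simp only [Y]; rw [key3 _ (by omega)]; omega
    · revert i; apply fin3_cases
      · simp [Y]; omega
      · simp only [Y]; simpa using (key4 (-1) (by omega)).ge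
      · simp only [Y]; simpa using (key3 (n + 1) (by omega)).ge
  · rintro (i | i) ω
    · simp only [X, Y, qwV, smul_smul, ← mul_assoc, zpow_neg, mul_inv_cancel, one_mul]
      rw [mul_smul, hA]; omega
    · revert i; apply fin3_cases
      · simp only [X, Y, qwV, if_true, hA]; omega
      · simp only [X, Y, qwV, one_ne_zero, if_true, if_false]
        simp only [smul_smul, ← mul_assoc, zpow_neg, inv_mul_cancel, one_mul]
        rw [mul_smul, hB]; omega
      · simp only [X, Y, qwV, Fin.reduceEq, if_false, smul_smul, ← mul_assoc, zpow_neg,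
          mul_inv_cancel, one_mul]
        rw [mul_smul, hA]; omega
  · rintro (i | i) ω
    · simp only [X, Y, qwV, smul_smul, mul_inv_rev, inv_inv, ← mul_assoc, zpow_neg,
        mul_inv_cancel, one_mul]
      rw [mul_smul, ← zpow_neg, hA]; omega
    · revert i; apply fin3_cases
      · simp only [X, Y, qwV, if_true, ← zpow_neg, hA]; omega
      · simp only [X, Y, qwV, one_ne_zero, if_true, if_false]
        simp only [smul_smul, mul_inv_rev, inv_inv, ← mul_assoc, zpow_neg, inv_mul_cancel, one_mul]
        rw [mul_smul, ← zpow_neg be, hB]; omega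
      · simp only [X, Y, qwV, Fin.reduceEq, if_false, smul_smul, mul_inv_rev, inv_inv,
          ← mul_assoc, zpow_neg, mul_inv_cancel, one_mul]
        rw [mul_smul, ← zpow_neg, hA]; omega

lemma qwU_injective {n : ℕ} {G K Ω : Type} [Group G] [Group K] [MulAction K Ω] (ι : G →* K)
    (x : Fin n → G) (w : G) (hw : w ≠ 1) (e : Fin n → ℕ) (he1 : ∀ i, 1 ≤ e i)
    (heinj : Function.Injective e) (a al : K)
    (A B : Ω → ℤ) (C : Ω → G) (hA : ∀ (k : ℤ) ω, A (a ^ k • ω) = A ω + k)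
    (hB : ∀ (k : ℤ) ω, B (al ^ k • ω) = B ω + k)
    (hC : ∀ g ω, C (ι g • ω) = g * C ω)
    (hAB : ∀ ω, A ω ≠ 0 → B ω = 0) (hAC : ∀ ω, A ω ≠ 0 → C ω = 1)
    (hBC : ∀ ω, B ω ≠ 0 → C ω = 1)
    (ω₀ : Ω) (hA0 : A ω₀ = 0) (hB0 : B ω₀ = 0) :
    Function.Injective (FreeGroup.lift (qwU (fun i => ι (x i)) (ι w) a al e)) := by
  have hBA : ∀ ω, B ω ≠ 0 → A ω = 0 := fun ω h => by
    by_contra h'; exact h (hAB ω h')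
  have hCA : ∀ ω, C ω ≠ 1 → A ω = 0 := fun ω h => by
    by_contra h'; exact h (hAC ω h')
  have hCB : ∀ ω, C ω ≠ 1 → B ω = 0 := fun ω h => by
    by_contra h'; exact h (hBC ω h')
  have key1 : ∀ (k : ℤ) ω, A (al ^ k • ω) ≠ 0 → B ω = -k := fun k ω h => by
    have := hAB _ h; rw [hB] at this; omega
  have key2 : ∀ (k : ℤ) ω, B (a ^ k • ω) ≠ 0 → A ω = -k := fun k ω h => by
    have := hBA _ h; rw [hA] at this; omega
  have key3 : ∀ (k : ℤ), k ≠ 0 → A (al ^ k • ω₀) = 0 := fun k hk => by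
    by_contra h; have := key1 _ _ h; omega
  have key4 : ∀ (k : ℤ), k ≠ 0 → B (a ^ k • ω₀) = 0 := fun k hk => by
    by_contra h; have := key2 _ _ h; omega
  -- if `B ≠ 0`, then `A` vanishes even after applying an element of `G`
  have push1 : ∀ g ω, B ω ≠ 0 → A (ι g • ω) = 0 := fun g ω h => by
    by_cases hg : g = 1
    · simp [hg, hBA _ h]
    · apply hCA; rw [hC, hBC _ h]; simpa using hg
  have push2 : ∀ g ω, A ω ≠ 0 → B (ι g • ω) = 0 := fun g ω h => by
    by_cases hg : g = 1
    · simp [hg, hAB _ h]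
    · apply hCB; rw [hC, hAC _ h]; simpa using hg
  let X : Fin n ⊕ Fin 3 → Ω → Prop := fun j ω => match j with
    | Sum.inl i => A ω = -(e i : ℤ)
    | Sum.inr t => if t = 0 then 0 < B (a ^ (-1 : ℤ) • ω)
        else if t = 1 then 0 < A (al ^ (-1 : ℤ) • ω)
        else C ω = w
  let Y : Fin n ⊕ Fin 3 → Ω → Prop := fun j ω => match j with
    | Sum.inl i => B ω = -(e i : ℤ)
    | Sum.inr t => if t = 0 then B (a ^ (-1 : ℤ) • ω) < 0
        else if t = 1 then A (al ^ (-1 : ℤ) • ω) < 0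
        else B ω = 2
  have X0 : ∀ ω, X (Sum.inr 0) ω → A ω = 1 := fun ω h => by
    apply key2 (-1); simp [X] at h ⊢; omega
  have Y0 : ∀ ω, Y (Sum.inr 0) ω → A ω = 1 := fun ω h => by
    apply key2 (-1); simp [Y] at h ⊢; omega
  have X1 : ∀ ω, X (Sum.inr 1) ω → B ω = 1 := fun ω h => by
    apply key1 (-1); simp [X] at h ⊢; omega
  have Y1 : ∀ ω, Y (Sum.inr 1) ω → B ω = 1 := fun ω h => by
    apply key1 (-1); simp [Y] at h ⊢; omega
  have X2 : ∀ ω, X (Sum.inr 2) ω → C ω ≠ 1 := fun ω h => by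
    simp [X] at h; rw [h]; exact hw
  have Y2 : ∀ ω, Y (Sum.inr 2) ω → B ω = 2 := fun ω h => by
    simpa [Y] using h
  have Xi : ∀ i ω, X (Sum.inl i) ω → A ω = -(e i : ℤ) := fun i ω h => h
  have Yi : ∀ i ω, Y (Sum.inl i) ω → B ω = -(e i : ℤ) := fun i ω h => h
  have anti : ∀ i ω, X i ω → Y i ω → False := by
    intro i ω
    rcases i with i | i
    · intro h1 h2
      have h1 := Xi _ _ h1; have h2 := Yi _ _ h2; have := hAB ω; have := he1 i; omega
    · revert i; apply fin3_cases
      · simp [X, Y]; intros; omega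
      · simp [X, Y]; intros; omega
      · intro h1 h2
        have h1 := hCB _ (X2 _ h1); have h2 := Y2 _ h2; omega
  have X2' : ∀ ω, X (Sum.inr 2) ω → A ω = 0 ∧ B ω = 0 := fun ω h =>
    ⟨hCA _ (X2 _ h), hCB _ (X2 _ h)⟩
  have sXX : ∀ i j ω, X i ω → X j ω → i = j := by
    intro i j ω
    have hAB' := hAB ω
    rcases i with i | i <;> rcases j with j | j
    · intro h1 h2
      have h1 := Xi _ _ h1
      have h2 := Xi _ _ h2
      congr 1; apply heinj; omega
    · intro h1
      have h1 := Xi _ _ h1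
      have := he1 i
      revert j; apply fin3_cases <;> intro h2
      · have := X0 _ h2; omega
      · have := X1 _ h2; omega
      · have := X2' _ h2; omega
    · intro h2 h1
      have h1 := Xi _ _ h1
      have := he1 j
      revert i; apply fin3_cases <;> intro h2
      · have := X0 _ h2; omega
      · have := X1 _ h2; omega
      · have := X2' _ h2; omega
    · revert i j; apply fin3_cases <;> apply fin3_cases <;> intro h1 h2
      · rfl
      · have := X0 _ h1; have := X1 _ h2; omega
      · have := X0 _ h1; have := X2' _ h2; omega
      · have := X1 _ h1; have := X0 _ h2; omega
      · rfl
      · have := X1 _ h1; have := X2' _ h2; omega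
      · have := X2' _ h1; have := X0 _ h2; omega
      · have := X2' _ h1; have := X1 _ h2; omega
      · rfl
  have sYY : ∀ i j ω, Y i ω → Y j ω → i = j := by
    intro i j ω
    have hAB' := hAB ω
    rcases i with i | i <;> rcases j with j | j
    · intro h1 h2
      have h1 := Yi _ _ h1
      have h2 := Yi _ _ h2
      congr 1; apply heinj; omega
    · intro h1
      have h1 := Yi _ _ h1
      have := he1 i
      revert j; apply fin3_cases <;> intro h2
      · have := Y0 _ h2; omega
      · have := Y1 _ h2; omega
      · have := Y2 _ h2; omega
    · intro h2 h1
      have h1 := Yi _ _ h1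
      have := he1 j
      revert i; apply fin3_cases <;> intro h2
      · have := Y0 _ h2; omega
      · have := Y1 _ h2; omega
      · have := Y2 _ h2; omega
    · revert i j; apply fin3_cases <;> apply fin3_cases <;> intro h1 h2
      · rfl
      · have := Y0 _ h1; have := Y1 _ h2; omega
      · have := Y0 _ h1; have := Y2 _ h2; omega
      · have := Y1 _ h1; have := Y0 _ h2; omega
      · rfl
      · have := Y1 _ h1; have := Y2 _ h2; omega
      · have := Y2 _ h1; have := Y0 _ h2; omega
      · have := Y2 _ h1; have := Y1 _ h2; omega
      · rfl
  have sXY : ∀ i j ω, X i ω → Y j ω → False := by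
    intro i j ω
    have hAB' := hAB ω
    rcases i with i | i <;> rcases j with j | j
    · intro h1 h2
      have h1 := Xi _ _ h1
      have h2 := Yi _ _ h2
      have := he1 i
      have := he1 j
      omega
    · intro h1
      have h1 := Xi _ _ h1
      have := he1 i
      revert j; apply fin3_cases <;> intro h2
      · have := Y0 _ h2; omega
      · have := Y1 _ h2; omega
      · have := Y2 _ h2; omega
    · intro h2 h1
      have h1 := Yi _ _ h1
      have := he1 j
      revert i; apply fin3_cases <;> intro h2
      · have := X0 _ h2; omega
      · have := X1 _ h2; omega
      · have := X2' _ h2; omega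
    · revert i j; apply fin3_cases <;> apply fin3_cases <;> intro h1 h2
      · exact anti (Sum.inr 0) ω h1 h2
      · have := X0 _ h1; have := Y1 _ h2; omega
      · have := X0 _ h1; have := Y2 _ h2; omega
      · have := X1 _ h1; have := Y0 _ h2; omega
      · exact anti (Sum.inr 1) ω h1 h2
      · have := X1 _ h1; have := Y2 _ h2; omega
      · have := X2' _ h1; have := Y0 _ h2; omega
      · have := X2' _ h1; have := Y1 _ h2; omega
      · exact anti (Sum.inr 2) ω h1 h2
  refine qw_ping_pong _ X Y ω₀ ?_ sXX sYY sXY ?_ ?_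
  · rintro (i | i)
    · intro h; have h := Yi _ _ h; have := he1 i; omega
    · revert i; apply fin3_cases
      · intro h; have h := Y0 _ h; omega
      · intro h; have h := Y1 _ h; omega
      · intro h; have h := Y2 _ h; omega
  · rintro (i | i) ω
    · intro h
      have h : B ω ≠ -(e i : ℤ) := h
      change A ((a ^ (-(e i : ℤ)) * ι (x i) * al ^ (e i : ℤ)) • ω) = -(e i : ℤ)
      rw [mul_smul, mul_smul, hA, push1, zero_add]
      rw [hB]; omega
    · revert i; apply fin3_cases
      · simp only [X, Y, qwU, if_true]
        simp only [smul_smul, ← mul_assoc, zpow_neg, inv_mul_cancel, one_mul]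
        rw [mul_smul, hB]; omega
      · simp only [X, Y, qwU, one_ne_zero, if_true, if_false]
        simp only [smul_smul, ← mul_assoc, zpow_neg, inv_mul_cancel, one_mul]
        rw [mul_smul, hA]; omega
      · simp only [X, Y, qwU, Fin.reduceEq, if_false]
        intro h
        rw [mul_smul, mul_smul, mul_smul, hC, hBC, mul_one]
        rw [hB, ← map_inv, hCB]
        · omega
        rw [hC, hBC, mul_one]
        · simpa using hw
        · rw [hB]; omega
  · rintro (i | i) ω
    · intro h
      have h : A ω ≠ -(e i : ℤ) := h
      change B ((a ^ (-(e i : ℤ)) * ι (x i) * al ^ (e i : ℤ))⁻¹ • ω) = -(e i : ℤ)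
      rw [mul_inv_rev, mul_inv_rev, mul_smul, mul_smul, ← zpow_neg, ← zpow_neg, ← map_inv, hB,
        push2, zero_add]
      rw [hA]; omega
    · revert i; apply fin3_cases
      · simp only [X, Y, qwU, if_true]
        simp only [smul_smul, mul_inv_rev, inv_inv, ← mul_assoc, zpow_neg, inv_mul_cancel, one_mul]
        rw [mul_smul, ← zpow_neg al, hB]; omega
      · simp only [X, Y, qwU, one_ne_zero, if_true, if_false]
        simp only [smul_smul, mul_inv_rev, inv_inv, ← mul_assoc, zpow_neg, inv_mul_cancel, one_mul]
        rw [mul_smul, ← zpow_neg a, hA]; omega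
      · simp only [X, Y, qwU, Fin.reduceEq, if_false]
        intro h
        simp only [mul_inv_rev, inv_inv, ← zpow_neg, neg_neg]
        rw [mul_smul, mul_smul, mul_smul, hB, hCB, zero_add]
        rw [hC, hBC, mul_one]
        · exact hw
        rw [hB, ← map_inv, hCB]
        · omega
        rw [hC]
        intro h'
        apply h
        have hh := inv_mul_eq_one.1 h'
        exact hh.symm

/-- The group acting: a free product of three copies of `G × ℤ`. -/
abbrev QwK (G : Type) [Group G] := Monoid.CoprodI (fun _ : Fin 3 => G × Multiplicative ℤ)

section
open Monoid Classical

noncomputable def qwHead {G : Type} [Group G] (i : Fin 3)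
    (ω : CoprodI.Word (fun _ : Fin 3 => G × Multiplicative ℤ)) : G × Multiplicative ℤ :=
  (CoprodI.Word.equivPair i ω).head

lemma qwHead_smul {G : Type} [Group G] (i : Fin 3) (m : G × Multiplicative ℤ)
    (ω : CoprodI.Word (fun _ : Fin 3 => G × Multiplicative ℤ)) :
    qwHead i ((CoprodI.of (M := fun _ : Fin 3 => G × Multiplicative ℤ) (i := i) m) • ω)
      = m * qwHead i ω := by
  unfold qwHead
  rw [CoprodI.Word.equivPair_smul_same]

lemma qwHead_excl {G : Type} [Group G] (i j : Fin 3) (hij : i ≠ j)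
    (ω : CoprodI.Word (fun _ : Fin 3 => G × Multiplicative ℤ)) (h : qwHead i ω ≠ 1) :
    qwHead j ω = 1 := by
  unfold qwHead at *
  have h1 : CoprodI.Word.fstIdx ω = some i := by
    by_contra h'
    rw [CoprodI.Word.equivPair_eq_of_fstIdx_ne h'] at h
    exact h rfl
  rw [CoprodI.Word.equivPair_eq_of_fstIdx_ne]
  rw [h1]
  simpa using hij

lemma qwHead_empty {G : Type} [Group G] (i : Fin 3) :
    qwHead i (CoprodI.Word.empty : CoprodI.Word (fun _ : Fin 3 => G × Multiplicative ℤ)) = 1 := by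
  unfold qwHead
  rw [CoprodI.Word.equivPair_eq_of_fstIdx_ne]
  simp [CoprodI.Word.fstIdx, CoprodI.Word.empty]

/-- The infinite cyclic generator in copy `i`. -/
def qwT (G : Type) [Group G] (i : Fin 3) : QwK G :=
  CoprodI.of (M := fun _ : Fin 3 => G × Multiplicative ℤ) (i := i) (1, Multiplicative.ofAdd 1)

/-- `G` inside copy `0`. -/
def qwI (G : Type) [Group G] : G →* QwK G :=
  (CoprodI.of (M := fun _ : Fin 3 => G × Multiplicative ℤ) (i := 0)).comp
    (MonoidHom.inl G (Multiplicative ℤ))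

lemma qwT_ne_one (G : Type) [Group G] (i : Fin 3) : qwT G i ≠ 1 := by
  intro h
  have : ((1, Multiplicative.ofAdd 1) : G × Multiplicative ℤ) = 1 :=
    CoprodI.of_injective (M := fun _ : Fin 3 => G × Multiplicative ℤ) i (by simpa [qwT] using h)
  have := congrArg Prod.snd this
  have := congrArg Multiplicative.toAdd this
  simp at this

lemma qwT_smul (G : Type) [Group G] (i : Fin 3) (k : ℤ)
    (ω : CoprodI.Word (fun _ : Fin 3 => G × Multiplicative ℤ)) :
    Multiplicative.toAdd (qwHead i (qwT G i ^ k • ω)).2 =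
      Multiplicative.toAdd (qwHead i ω).2 + k := by
  rw [qwT, ← map_zpow, qwHead_smul]
  simp [add_comm]

lemma qw_free (G : Type) [Group G] (n : ℕ) :
    Function.Injective (FreeGroup.lift (qwV n (qwT G 1) (qwT G 2))) := by
  refine qwV_injective n _ _ (fun ω => Multiplicative.toAdd (qwHead 1 ω).2)
    (fun ω => Multiplicative.toAdd (qwHead 2 ω).2) (qwT_smul G 1) (qwT_smul G 2) ?_
    CoprodI.Word.empty ?_ ?_
  · intro ω h
    rw [qwHead_excl 1 2 (by decide)]
    · rfl
    · intro h'; apply h; rw [h']; rfl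
  · rw [qwHead_empty]; rfl
  · rw [qwHead_empty]; rfl

lemma qw_free' (G : Type) [Group G] {n : ℕ} (x : Fin n → G) (w : G) (hw : w ≠ 1)
    (e : Fin n → ℕ) (he1 : ∀ i, 1 ≤ e i) (heinj : Function.Injective e) :
    Function.Injective (FreeGroup.lift
      (qwU (fun i => qwI G (x i)) (qwI G w) (qwT G 1) (qwT G 2) e)) := by
  refine qwU_injective (qwI G) x w hw e he1 heinj _ _
    (fun ω => Multiplicative.toAdd (qwHead 1 ω).2)
    (fun ω => Multiplicative.toAdd (qwHead 2 ω).2) (fun ω => (qwHead 0 ω).1)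
    (qwT_smul G 1) (qwT_smul G 2) ?_ ?_ ?_ ?_ CoprodI.Word.empty ?_ ?_
  · intro g ω
    change (qwHead 0 (CoprodI.of (M := fun _ : Fin 3 => G × Multiplicative ℤ) (i := 0)
      (g, 1) • ω)).1 = _
    rw [qwHead_smul]; rfl
  · intro ω h
    rw [qwHead_excl 1 2 (by decide)]
    · rfl
    · intro h'; apply h; rw [h']; rfl
  · intro ω h
    rw [qwHead_excl 1 0 (by decide)]
    · rfl
    · intro h'; apply h; rw [h']; rfl
  · intro ω h
    rw [qwHead_excl 2 0 (by decide)]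
    · rfl
    · intro h'; apply h; rw [h']; rfl
  · rw [qwHead_empty]; rfl
  · rw [qwHead_empty]; rfl

end

/-- The exponents. -/
def qwE (n p : ℕ) (q : Fin p → ℕ) (i : Fin n) : ℕ :=
  if h : (i : ℕ) < p then q ⟨i, h⟩ else Finset.univ.sup q + (i : ℕ) + 1

lemma qwE_pos (n p : ℕ) (q : Fin p → ℕ) (hq1 : ∀ i, 1 ≤ q i) (i : Fin n) :
    1 ≤ qwE n p q i := by
  unfold qwE; split_ifs
  · exact hq1 _
  · omega

lemma qwE_inj (n p : ℕ) (q : Fin p → ℕ) (hq : Function.Injective q) :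
    Function.Injective (qwE n p q) := by
  have hle : ∀ i, q i ≤ Finset.univ.sup q := fun i => Finset.le_sup (Finset.mem_univ i)
  intro i j h
  unfold qwE at h
  split_ifs at h with h1 h2 h2
  · have := hq h; simp at this; exact Fin.ext this
  · have := hle ⟨i, h1⟩; omega
  · have := hle ⟨j, h2⟩; omega
  · ext; omega

/-- Values of a homomorphism on the relators. -/
lemma qw_lift_rel (n m p : ℕ) (r : Fin m → FreeGroup (Fin n)) (q : Fin p → ℕ)
    (w : FreeGroup (Fin n)) {P : Type} [Group P] (F : FreeGroup (QwGen n) →* P)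
    (j : Fin n ⊕ Fin 3) :
    F (qwRel n m p r q w (Sum.inr j)) =
      qwU (fun i => F (FreeGroup.of (Sum.inl i))) (F (FreeGroup.map Sum.inl w))
        (F (FreeGroup.of (Sum.inr 0))) (F (FreeGroup.of (Sum.inr 1))) (qwE n p q) j *
      (qwV n (F (FreeGroup.of (Sum.inr 2))) (F (FreeGroup.of (Sum.inr 3))) j)⁻¹ := by
  rcases j with i | t
  · simp only [qwRel, qwU, qwV, qwE]
    split_ifs with h
    · simp only [map_mul, map_inv, map_zpow, map_pow, zpow_one, zpow_natCast]
      norm_cast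
    · simp only [map_mul, map_inv, map_zpow, map_pow, zpow_one, zpow_natCast]
      norm_cast
  · revert t; apply fin3_cases
    · simp [qwRel, qwU, qwV]
    · simp [qwRel, qwU, qwV]
    · simp [qwRel, qwU, qwV]; norm_cast

lemma qwU_map {n : ℕ} {K K' : Type} [Group K] [Group K'] (f : K →* K') (x : Fin n → K)
    (W a al : K) (e : Fin n → ℕ) (j : Fin n ⊕ Fin 3) :
    f (qwU x W a al e j) = qwU (fun i => f (x i)) (f W) (f a) (f al) e j := by
  rcases j with i | t
  · simp only [qwU, map_mul, map_zpow]
  · simp only [qwU]; split_ifs <;> simp only [map_mul, map_zpow, map_inv]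

lemma qwV_map (n : ℕ) {K K' : Type} [Group K] [Group K'] (f : K →* K')
    (b be : K) (j : Fin n ⊕ Fin 3) :
    f (qwV n b be j) = qwV n (f b) (f be) j := by
  rcases j with i | t
  · simp only [qwV, map_mul, map_zpow]
  · simp only [qwV]; split_ifs <;> simp only [map_mul, map_zpow]

lemma qw_nontrivial (n m p : ℕ) (r : Fin m → FreeGroup (Fin n)) (q : Fin p → ℕ)
    (hq1 : ∀ i, 1 ≤ q i) (hqinj : Function.Injective q) (w : FreeGroup (Fin n))
    (hw : PresentedGroup.mk (Set.range r) w ≠ 1) :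
    ¬ Subsingleton (PresentedGroup (Set.range (qwRel n m p r q w))) := by
  intro hsub
  let G := PresentedGroup (Set.range r)
  let u : Fin n ⊕ Fin 3 → QwK G :=
    qwU (fun i => qwI G (PresentedGroup.of i)) (qwI G (PresentedGroup.mk _ w))
      (qwT G 1) (qwT G 2) (qwE n p q)
  let v : Fin n ⊕ Fin 3 → QwK G := qwV n (qwT G 1) (qwT G 2)
  let φ : Bool → (FreeGroup (Fin n ⊕ Fin 3) →* QwK G) :=
    fun c => if c then FreeGroup.lift v else FreeGroup.lift u
  have hφ : ∀ c, Function.Injective (φ c) := by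
    rintro (_ | _)
    · exact qw_free' G _ _ hw _ (qwE_pos n p q hq1) (qwE_inj n p q hqinj)
    · exact qw_free G n
  let L : QwK G →* Monoid.PushoutI φ := Monoid.PushoutI.of (φ := φ) false
  let R : QwK G →* Monoid.PushoutI φ := Monoid.PushoutI.of (φ := φ) true
  have hLR : ∀ j, L (u j) = R (v j) := fun j => by
    have h1 := Monoid.PushoutI.of_apply_eq_base φ false (FreeGroup.of j)
    have h2 := Monoid.PushoutI.of_apply_eq_base φ true (FreeGroup.of j)
    have h3 := h1.trans h2.symm
    simpa [φ] using h3
  let f : QwGen n → Monoid.PushoutI φ := Sum.elim (fun i => L (qwI G (PresentedGroup.of i)))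
    ![L (qwT G 1), L (qwT G 2), R (qwT G 1), R (qwT G 2)]
  have hmap : ∀ z : FreeGroup (Fin n), FreeGroup.lift f (FreeGroup.map Sum.inl z) =
      L (qwI G (PresentedGroup.mk _ z)) := by
    intro z
    have : (FreeGroup.lift f).comp (FreeGroup.map Sum.inl) =
        (L.comp (qwI G)).comp (PresentedGroup.mk (Set.range r)) := by
      ext i
      simp [f, PresentedGroup.of]
    exact DFunLike.congr_fun this z
  have hrel : ∀ z ∈ Set.range (qwRel n m p r q w), FreeGroup.lift f z = 1 := by
    rintro _ ⟨j | j, rfl⟩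
    · change FreeGroup.lift f (FreeGroup.map Sum.inl (r j)) = 1
      rw [hmap, PresentedGroup.one_of_mem (Set.mem_range_self j), map_one, map_one]
    · rw [qw_lift_rel, mul_inv_eq_one, hmap]
      have h := hLR j
      have h1 := qwU_map (K' := Monoid.PushoutI φ) L (fun i => qwI G (PresentedGroup.of i))
        (qwI G (PresentedGroup.mk _ w)) (qwT G 1) (qwT G 2) (qwE n p q) j
      have h2 := qwV_map n (K' := Monoid.PushoutI φ) R (qwT G 1) (qwT G 2) j
      have h' := h1.symm.trans (h.trans h2)
      simpa [f] using h'
  have hb : PresentedGroup.toGroup hrel (PresentedGroup.of (Sum.inr 2)) = 1 := by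
    rw [Subsingleton.elim (PresentedGroup.of (Sum.inr 2)) 1, map_one]
  rw [PresentedGroup.toGroup.of] at hb
  have hb : R (qwT G 1) = 1 := by simpa [f] using hb
  have := Monoid.PushoutI.of_injective hφ true (hb.trans (map_one R).symm)
  exact qwT_ne_one G 1 this

lemma qw_subsingleton (n m p : ℕ) (hp1 : 1 ≤ p) (hpn : p ≤ n)
    (r : Fin m → FreeGroup (Fin n)) (q : Fin p → ℕ)
    (horder : ∀ i : Fin p,
      orderOf (Abelianization.of
        (PresentedGroup.of (rels := Set.range r) (Fin.castLE hpn i))) = q i)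
    (hgcd : Finset.univ.gcd q = 1) (w : FreeGroup (Fin n))
    (hw : PresentedGroup.mk (Set.range r) w = 1) :
    Subsingleton (PresentedGroup (Set.range (qwRel n m p r q w))) := by
  let F := PresentedGroup.mk (Set.range (qwRel n m p r q w))
  have hF : ∀ j, F (qwRel n m p r q w j) = 1 := fun j => PresentedGroup.one_of_mem ⟨j, rfl⟩
  let ψ : PresentedGroup (Set.range r) →* PresentedGroup (Set.range (qwRel n m p r q w)) :=
    PresentedGroup.map (FreeGroup.map Sum.inl) (by
      rintro _ ⟨j, rfl⟩
      exact ⟨Sum.inl j, rfl⟩)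
  have hψ : ∀ z, ψ (PresentedGroup.mk _ z) = F (FreeGroup.map Sum.inl z) := fun z => rfl
  have hW : F (FreeGroup.map Sum.inl w) = 1 := by rw [← hψ, hw, map_one]
  have hrel : ∀ j, qwU (fun i => F (FreeGroup.of (Sum.inl i))) (F (FreeGroup.map Sum.inl w))
        (F (FreeGroup.of (Sum.inr 0))) (F (FreeGroup.of (Sum.inr 1))) (qwE n p q) j =
      qwV n (F (FreeGroup.of (Sum.inr 2))) (F (FreeGroup.of (Sum.inr 3))) j := fun j => by
    rw [← mul_inv_eq_one, ← qw_lift_rel n m p r q w F j, hF]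
  rw [hW] at hrel
  generalize ha : F (FreeGroup.of (Sum.inr 0)) = a at hrel
  generalize hal : F (FreeGroup.of (Sum.inr 1)) = al at hrel
  generalize hb : F (FreeGroup.of (Sum.inr 2)) = b at hrel
  generalize hbe : F (FreeGroup.of (Sum.inr 3)) = be at hrel
  have b1 : b = 1 := by
    have h := hrel (Sum.inr 2)
    simp only [qwU, qwV, Fin.reduceEq, if_false, one_mul, inv_one, mul_one,
      zpow_one, zpow_neg] at h
    have h' := congrArg (fun z => be ^ (n + 1 : ℤ) * z * (be ^ (n + 1 : ℤ))⁻¹) h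
    simpa [mul_assoc] using h'.symm
  have al1 : al = 1 := by
    have h := hrel (Sum.inr 0)
    simpa [qwU, qwV, b1] using h
  have abe : a = be := by
    have h := hrel (Sum.inr 1)
    simpa [qwU, qwV, b1, al1] using h
  have hx : ∀ i, F (FreeGroup.of (Sum.inl i)) = a ^ (qwE n p q i) := fun i => by
    have h := hrel (Sum.inl i)
    simp only [qwU, qwV, b1, al1, one_zpow, mul_one, zpow_neg, inv_mul_cancel, zpow_natCast,
      one_pow, inv_mul_eq_one] at h
    exact h.symm
  -- `G` maps to the cyclic group generated by `a`
  have hmem : ∀ g, ψ g ∈ Subgroup.zpowers a := by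
    have : ∀ g, g ∈ (Subgroup.zpowers a).comap ψ := by
      refine PresentedGroup.generated_by _ _ fun i => ?_
      rw [Subgroup.mem_comap]
      change ψ (PresentedGroup.mk _ (FreeGroup.of i)) ∈ _
      rw [hψ, FreeGroup.map.of, hx]
      exact Subgroup.npow_mem_zpowers a _
    exact this
  let χ : PresentedGroup (Set.range r) →* Subgroup.zpowers a := ψ.codRestrict _ hmem
  let _ : CommGroup (Subgroup.zpowers a) :=
    { (inferInstance : Group (Subgroup.zpowers a)) with
      mul_comm := by
        rintro ⟨_, k, rfl⟩ ⟨_, l, rfl⟩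
        exact Subtype.ext (zpow_mul_comm a k l) }
  have hpow : ∀ i : Fin p, a ^ (q i * q i) = 1 := by
    intro i
    have h1 := pow_orderOf_eq_one (Abelianization.of
        (PresentedGroup.of (rels := Set.range r) (Fin.castLE hpn i)))
    rw [horder] at h1
    have h2 := congrArg (Abelianization.lift (A := Subgroup.zpowers a) χ) h1
    rw [map_pow, map_one, Abelianization.lift_apply_of] at h2
    have h3 := congrArg (Subtype.val) h2
    have h4 : ψ (PresentedGroup.mk _ (FreeGroup.of (Fin.castLE hpn i))) ^ q i = 1 := h3
    rw [hψ, FreeGroup.map.of, hx, ← pow_mul] at h4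
    simpa [qwE] using h4
  have a1 : a = 1 := by
    rw [← orderOf_eq_one_iff]
    rw [Nat.eq_one_iff_not_exists_prime_dvd]
    intro l hl hdvd
    have : l ∣ Finset.univ.gcd q := by
      refine Finset.dvd_gcd fun i _ => ?_
      have := hdvd.trans (orderOf_dvd_of_pow_eq_one (hpow i))
      rcases hl.dvd_mul.1 this with h | h <;> exact h
    rw [hgcd] at this
    exact hl.one_lt.ne' (Nat.dvd_one.1 this)
  have htriv : ∀ z : PresentedGroup (Set.range (qwRel n m p r q w)), z ∈
      (⊥ : Subgroup (PresentedGroup (Set.range (qwRel n m p r q w)))) := by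
    refine PresentedGroup.generated_by _ _ ?_
    have hm1 : ∀ y, F (FreeGroup.of y) = 1 → PresentedGroup.of y ∈
      (⊥ : Subgroup (PresentedGroup (Set.range (qwRel n m p r q w)))) := fun y h =>
        Subgroup.mem_bot.2 h
    rintro (i | t)
    · apply hm1; rw [hx, a1, one_pow]
    · apply hm1
      fin_cases t
      · exact ha.trans a1
      · exact hal.trans al1
      · exact hb.trans b1
      · exact hbe.trans (abe.symm.trans a1)
  exact ⟨fun y z => by rw [Subgroup.mem_bot.1 (htriv y), Subgroup.mem_bot.1 (htriv z)]⟩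

/-- Let `P = (x₁,…,xₙ : r₁,…,r_m)` be a finite presentation of a
group `G = PresentedGroup (Set.range r)` satisfying condition (2.1) with distinct
orders `q₁,…,q_p`, and let `w` be a word in `x₁,…,xₙ`.  Then the group `G_w`
presented by `Q_w` is trivial if and only if `[w] = 1` in `G`. -/
theorem qw_trivial_iff (n m p : ℕ) (hp1 : 1 ≤ p) (hpn : p ≤ n)
    (r : Fin m → FreeGroup (Fin n)) (q : Fin p → ℕ)
    (hq1 : ∀ i, 1 ≤ q i) (hqinj : Function.Injective q)
    (horder : ∀ i : Fin p,
      orderOf (Abelianization.of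
        (PresentedGroup.of (rels := Set.range r) (Fin.castLE hpn i))) = q i)
    (hgcd : Finset.univ.gcd q = 1)
    (w : FreeGroup (Fin n)) :
    Subsingleton (PresentedGroup (Set.range (qwRel n m p r q w))) ↔
      PresentedGroup.mk (Set.range r) w = 1 := by
  constructor
  · intro h
    by_contra hw
    exact qw_nontrivial n m p r q hq1 hqinj w hw h
  · exact qw_subsingleton n m p hp1 hpn r q horder hgcd w
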